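/- Let G be a group, κ ∈ G central with κ ≠ 1 and κ² = 1. Let g₁, g₂ ∈ G have conjugacy classes {g₁, κ·g₁} and {g₂, κ·g₂} with g₁·g₂ = κ·g₂·g₁, let g₃, g₄ ∈ G be central, and suppose G is generated by g₁, g₂, g₃, g₄. Let χ₁ : C_G(g₁) → kˣ, χ₂ : C_G(g₂) → kˣ and χ₃, χ₄ : G → kˣ be group homomorphisms with χ_i(g_i) = −1 for i = 1, 2, 3, 4, satisfying χ₁(κ·g₂²)·χ₂(κ·g₁²) = 1, χ₁(g₃)·χ₃(g₁) = 1, χ₁(g₄)·χ₄(g₁) = 1, χ₂(g₄)·χ₄(g₂) = 1, χ₃(g₄)·χ₄(g₃) = −1 and χ₂(g₃)·χ₃(g₂) = −1 (the conditions defining a Yetter–Drinfeld module of type φ₄, with Cartan matrix of type F₄, whose support generates G). Then there exists a 2-cocycle σ on G with values in kˣ such that σ(g_i, κ)·σ(κ, g_i)⁻¹·χ_i(κ) = 1 for i = 1, 2, 3, 4. -/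

import Mathlib

theorem exists_retraction_units_of_isAlgClosed {k : Type*} [Field k] [IsAlgClosed k]
    {M : Type*} [CommGroup M] (j : kˣ →* M) (hj : Function.Injective j) :
    ∃ φ : M →* kˣ, ∀ s, φ (j s) = s := by
  have hroot : ∀ {n : ℤ}, n ≠ 0 → ∀ a : kˣ, ∃ b : kˣ, b ^ n = a := by
    intro n hn a
    obtain ⟨b, hb⟩ := IsAlgClosed.exists_pow_nat_eq (a : k) (Int.natAbs_pos.mpr hn)
    have hb0 : b ≠ 0 := by
      rintro rfl
      rw [zero_pow (Int.natAbs_ne_zero.mpr hn)] at hb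
      exact a.ne_zero hb.symm
    have hb' : (Units.mk0 b hb0) ^ n.natAbs = a := Units.ext (by simpa using hb)
    rcases Int.natAbs_eq n with h | h
    · exact ⟨Units.mk0 b hb0, by rw [h, zpow_natCast, hb']⟩
    · exact ⟨(Units.mk0 b hb0)⁻¹, by rw [h, zpow_neg, zpow_natCast, inv_pow, hb', inv_inv]⟩
  let : DivisibleBy (Additive kˣ) ℤ := divisibleByOfSMulRightSurj _ _
    fun {n} hn a => hroot hn a.toMul
  obtain ⟨h, hh⟩ := (Module.Baer.of_divisible (Additive kˣ)).extension_property_addMonoidHom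
    (MonoidHom.toAdditive j) hj (AddMonoidHom.id _)
  exact ⟨MonoidHom.toAdditive.symm h, fun s => DFunLike.congr_fun hh (Additive.ofMul s)⟩

theorem exists_cocycle_of_central_extension {k : Type*} [Field k] [IsAlgClosed k]
    {P G : Type*} [Group P] [Group G] (π : P →* G) (hπ : Function.Surjective π)
    (hker : ∀ x, π x = 1 → ∀ y, y * x = x * y)
    (j : kˣ →* P) (hj : Function.Injective j) (hπj : ∀ s, π (j s) = 1) :
    ∃ σ : G → G → kˣ,
      (∀ a b c : G, σ a b * σ (a * b) c = σ a (b * c) * σ b c) ∧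
      ∀ x y s, x * y * x⁻¹ = j s * y → σ (π x) (π y) * (σ (π y) (π x))⁻¹ = s := by
  have hcen : ∀ x, π x = 1 → x ∈ Subgroup.center P :=
    fun x hx => Subgroup.mem_center_iff.mpr (hker x hx)
  let : CommGroup (Subgroup.center P) :=
    { (inferInstance : Group (Subgroup.center P)) with
      mul_comm := fun a b => Subtype.ext (Subgroup.mem_center_iff.mp b.2 a) }
  obtain ⟨φ, hφ⟩ := exists_retraction_units_of_isAlgClosed
    (j.codRestrict (Subgroup.center P) fun s => hcen _ (hπj s))
    (fun a b h => hj (congrArg (Subgroup.center P).subtype h))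
  obtain ⟨s, hs⟩ := hπ.hasRightInverse
  have hmem : ∀ a b, s a * s b * (s (a * b))⁻¹ ∈ Subgroup.center P :=
    fun a b => hcen _ (by simp [hs _])
  refine ⟨fun a b => φ ⟨_, hmem a b⟩, fun a b c => ?_, fun x y t h => ?_⟩
  · rw [← map_mul, ← map_mul]
    congr 1
    apply Subtype.ext
    have hz := Subgroup.mem_center_iff.mp (hmem b c)
    calc s a * s b * (s (a * b))⁻¹ * (s (a * b) * s c * (s (a * b * c))⁻¹)
        = s a * (s b * s c * (s (b * c))⁻¹) * (s (b * c) * (s (a * (b * c)))⁻¹) := by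
          rw [mul_assoc a b c]; group
      _ = s a * s (b * c) * (s (a * (b * c)))⁻¹ * (s b * s c * (s (b * c))⁻¹) := by
          rw [mul_assoc, ← hz]; group
  · have hxy : π x * π y = π y * π x := by
      have := congrArg π h
      rw [map_mul, map_mul, map_mul, hπj, one_mul, map_inv, mul_inv_eq_iff_eq_mul] at this
      exact this
    have hzx := hker ((s (π x)) * x⁻¹) (by simp [hs _])
    have hzy := hker ((s (π y)) * y⁻¹) (by simp [hs _])
    rw [← map_inv, ← map_mul, ← hφ t]
    congr 1
    apply Subtype.ext
    change s (π x) * s (π y) * (s (π x * π y))⁻¹ * (s (π y) * s (π x) * (s (π y * π x))⁻¹)⁻¹ = j t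
    rw [← hxy, eq_mul_inv_iff_mul_eq.mpr h.symm]
    generalize s (π x) = X at *
    generalize s (π y) = Y at *
    obtain ⟨u, rfl⟩ : ∃ u, X = u * x := ⟨X * x⁻¹, by group⟩
    obtain ⟨v, rfl⟩ : ∃ v, Y = v * y := ⟨Y * y⁻¹, by group⟩
    simp only [mul_inv_cancel_right] at hzx hzy
    calc _ = u * (x * v) * y * (x⁻¹ * u⁻¹) * y⁻¹ * v⁻¹ := by group
      _ = v * u * (x * y * x⁻¹ * u⁻¹ * y⁻¹) * v⁻¹ := by rw [hzy x, ← mul_assoc u, hzy u]; group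
      _ = u * (x * y * x⁻¹) * (u⁻¹ * y⁻¹) := by rw [mul_assoc v, ← hzy]; group
      _ = _ := by rw [← hzx]; group

theorem exists_normal_form_of_mem_closure {W : Type*} [Group W] {x₁ x₂ x₃ x₄ K : W}
    (h₁₂ : x₁ * x₂ = K * (x₂ * x₁)) (hK₁ : Commute K x₁) (hK₂ : Commute K x₂)
    (h₁₃ : Commute x₁ x₃) (h₁₄ : Commute x₁ x₄) (h₂₃ : Commute x₂ x₃) (h₂₄ : Commute x₂ x₄)
    (h₃₄ : Commute x₃ x₄) {w : W} (hw : w ∈ Subgroup.closure {x₁, x₂, x₃, x₄}) :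
    ∃ a b c d e : ℤ, w = x₁ ^ a * x₂ ^ b * x₃ ^ c * x₄ ^ d * K ^ e := by
  have hKx : K = x₁ * x₂ * x₁⁻¹ * x₂⁻¹ := by rw [h₁₂]; group
  have key : ∀ (a : ℤ), x₂ * x₁ ^ a = x₁ ^ a * x₂ * K ^ (-a) := by
    intro a
    have h : x₂ * x₁ * x₂⁻¹ = x₁ * K⁻¹ := by
      rw [(hK₁.symm.inv_right).eq, mul_inv_eq_iff_eq_mul, mul_assoc, h₁₂]; group
    have := conj_zpow (a := x₂) (b := x₁) (i := a)
    rw [h, hK₁.symm.inv_right.mul_zpow, inv_zpow', eq_mul_inv_iff_mul_eq, mul_assoc] at this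
    rw [← this, (hK₂.zpow_left _).eq, mul_assoc]
  have key' : ∀ (a : ℤ), x₂⁻¹ * x₁ ^ a = x₁ ^ a * x₂⁻¹ * K ^ a := by
    intro a
    rw [inv_mul_eq_iff_eq_mul, ← mul_assoc, ← mul_assoc, key, mul_assoc, mul_assoc, mul_assoc,
      ← mul_assoc (K ^ (-a)), ((hK₂.zpow_left (-a)).inv_right).eq]
    group
  have h₃K : Commute x₃ K := by
    rw [hKx]
    exact ((h₁₃.symm.mul_right h₂₃.symm).mul_right h₁₃.symm.inv_right).mul_right h₂₃.symm.inv_right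
  have h₄K : Commute x₄ K := by
    rw [hKx]
    exact ((h₁₄.symm.mul_right h₂₄.symm).mul_right h₁₄.symm.inv_right).mul_right h₂₄.symm.inv_right
  have hx₂ : ∀ (y : W) (n : ℤ), Commute K y → ∀ a b c d e : ℤ,
      y * x₁ ^ a = x₁ ^ a * y * K ^ n →
      y * (x₁ ^ a * x₂ ^ b * x₃ ^ c * x₄ ^ d * K ^ e) =
        x₁ ^ a * (y * x₂ ^ b) * x₃ ^ c * x₄ ^ d * K ^ (n + e) := by
    intro y n hy a b c d e h
    have hc : Commute (K ^ n) (x₂ ^ b * x₃ ^ c * x₄ ^ d) :=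
      ((hK₂.zpow_zpow _ _).mul_right (h₃K.symm.zpow_zpow _ _)).mul_right (h₄K.symm.zpow_zpow _ _)
    calc _ = (y * x₁ ^ a) * (x₂ ^ b * x₃ ^ c * x₄ ^ d) * K ^ e := by simp only [mul_assoc]
      _ = x₁ ^ a * y * (K ^ n * (x₂ ^ b * x₃ ^ c * x₄ ^ d)) * K ^ e := by
        rw [h]; simp only [mul_assoc]
      _ = _ := by rw [hc.eq, zpow_add]; simp only [mul_assoc]
  have hx₃ : ∀ (y : W), Commute y x₁ → Commute y x₂ → ∀ a b : ℤ, ∀ z : W,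
      y * (x₁ ^ a * x₂ ^ b * z) = x₁ ^ a * x₂ ^ b * (y * z) := by
    intro y h1 h2 a b z
    rw [← mul_assoc, ((h1.zpow_right a).mul_right (h2.zpow_right b)).eq, mul_assoc]
  have hx₄ : ∀ (y : W), Commute y x₃ → ∀ c : ℤ, ∀ z : W,
      y * (x₃ ^ c * z) = x₃ ^ c * (y * z) := by
    intro y h1 a z
    rw [← mul_assoc, (h1.zpow_right a).eq, mul_assoc]
  induction hw using Subgroup.closure_induction_left with
  | one => exact ⟨0, 0, 0, 0, 0, by simp⟩
  | mul_left x hx y _ ih =>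
    obtain ⟨a, b, c, d, e, rfl⟩ := ih
    rcases hx with rfl | rfl | rfl | rfl
    · exact ⟨1 + a, b, c, d, e, by simp only [zpow_add, zpow_one, mul_assoc]⟩
    · exact ⟨a, 1 + b, c, d, -a + e, by rw [hx₂ _ _ hK₂ _ _ _ _ _ (key a), zpow_one_add]⟩
    · refine ⟨a, b, 1 + c, d, e, ?_⟩
      have := hx₃ _ h₁₃.symm h₂₃.symm a b (x ^ c * x₄ ^ d * K ^ e)
      simpa only [zpow_one_add, mul_assoc] using this
    · refine ⟨a, b, c, 1 + d, e, ?_⟩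
      have := hx₃ _ h₁₄.symm h₂₄.symm a b (x₃ ^ c * (x ^ d * K ^ e))
      rw [hx₄ _ h₃₄.symm] at this
      simpa only [zpow_one_add, mul_assoc] using this
  | inv_mul_cancel x hx y _ ih =>
    obtain ⟨a, b, c, d, e, rfl⟩ := ih
    rcases hx with rfl | rfl | rfl | rfl
    · exact ⟨-1 + a, b, c, d, e, by simp only [zpow_add, zpow_neg_one, mul_assoc]⟩
    · exact ⟨a, -1 + b, c, d, a + e, by
        rw [hx₂ _ _ hK₂.inv_right _ _ _ _ _ (key' a), zpow_add _ (-1), zpow_neg_one]⟩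
    · refine ⟨a, b, -1 + c, d, e, ?_⟩
      have := hx₃ _ h₁₃.symm.inv_left h₂₃.symm.inv_left a b (x ^ c * x₄ ^ d * K ^ e)
      simpa only [zpow_add, zpow_neg_one, mul_assoc] using this
    · refine ⟨a, b, c, -1 + d, e, ?_⟩
      have := hx₃ _ h₁₄.symm.inv_left h₂₄.symm.inv_left a b (x₃ ^ c * (x ^ d * K ^ e))
      rw [hx₄ _ h₃₄.symm.inv_left] at this
      simpa only [zpow_add, zpow_neg_one, mul_assoc] using this

theorem even_of_character_relations {A : Type*} [AddCommGroup A] {p q x y z w u m s t : A}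
    (hm0 : m ≠ 0) (hm : (2 : ℤ) • m = 0) (hs : (2 : ℤ) • s = 0) (ht : (2 : ℤ) • t = 0)
    (hpq : s + p + (t + q) = 0) {a b c d e : ℤ}
    (h₁ : b • p + c • x + d • y + e • s = 0)
    (h₂ : a • q + c • w + d • z + e • t = 0)
    (h₃ : (2 * a) • (-x) + (2 * b) • (m - w) + c • m + d • u = 0)
    (h₄ : (2 * a) • (-y) + (2 * b) • (-z) + c • (m - u) + d • m = 0) :
    Even c ∧ Even d := by
  have key : (c ^ 2 + c * d + d ^ 2) • m = 0 := by
    linear_combination (norm := module) (2 * a) • h₁ + (2 * b) • h₂ + c • h₃ + d • h₄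
      - (2 * a * b) • hpq + (a * b - a * e) • hs + (a * b - b * e) • ht - (b * c) • hm
  have hne : ¬ Odd (c ^ 2 + c * d + d ^ 2) := by
    rintro ⟨n, hn⟩
    rw [hn, add_smul, mul_comm, mul_smul, hm, smul_zero, zero_add, one_smul] at key
    exact hm0 key
  rw [Int.not_odd_iff_even] at hne
  rcases Int.even_or_odd c with hc | hc <;> rcases Int.even_or_odd d with hd | hd <;>
    simp_all [Int.even_add, Int.even_mul, Int.even_pow, ← Int.not_even_iff_odd]

/-- The product of the unit group of a `k`-algebra `A` with `ι → ℤ`, with multiplication twisted by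
the bicharacter of `ι → ℤ` taking the value `α i j` at the pair of basis vectors `(i, j)`. -/
@[ext]
structure TwistedUnits {k : Type*} (A : Type*) [Field k] [Ring A] [Algebra k A] {ι : Type*}
    (α : ι → ι → kˣ) where
  /-- The unit component. -/
  unit : Aˣ
  /-- The exponent component. -/
  exponent : ι → ℤ

namespace TwistedUnits

variable {k A ι : Type*} [Field k] [Ring A] [Algebra k A] [Fintype ι] {α : ι → ι → kˣ}

/-- The bicharacter of `ι → ℤ` with prescribed values on basis vectors. -/
def bicharacter (α : ι → ι → kˣ) (v w : ι → ℤ) : kˣ := ∏ i, ∏ j, α i j ^ (v i * w j)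

theorem bicharacter_add_left (u v w : ι → ℤ) :
    bicharacter α (u + v) w = bicharacter α u w * bicharacter α v w := by
  simp [bicharacter, add_mul, zpow_add, Finset.prod_mul_distrib]

theorem bicharacter_add_right (u v w : ι → ℤ) :
    bicharacter α u (v + w) = bicharacter α u v * bicharacter α u w := by
  simp [bicharacter, mul_add, zpow_add, Finset.prod_mul_distrib]

@[simp]
theorem bicharacter_zero_left (w : ι → ℤ) : bicharacter α 0 w = 1 := by simp [bicharacter]

@[simp]
theorem bicharacter_zero_right (w : ι → ℤ) : bicharacter α w 0 = 1 := by simp [bicharacter]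

@[simp]
theorem bicharacter_single [DecidableEq ι] (i j : ι) :
    bicharacter α (Pi.single i 1) (Pi.single j 1) = α i j := by
  simp [bicharacter, Pi.single_apply, apply_ite]

variable (A) in
/-- The inclusion of the scalars in the unit group of an algebra. -/
abbrev unitScalar : kˣ →* Aˣ := Units.map (algebraMap k A).toMonoidHom

theorem unitScalar_mul_comm (s : kˣ) (u : Aˣ) : unitScalar A s * u = u * unitScalar A s :=
  Units.ext (Algebra.commutes _ _)

instance : Mul (TwistedUnits A α) :=
  ⟨fun x y => ⟨x.unit * y.unit * unitScalar A (bicharacter α x.exponent y.exponent),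
    x.exponent + y.exponent⟩⟩

instance : One (TwistedUnits A α) := ⟨⟨1, 0⟩⟩

instance : Inv (TwistedUnits A α) :=
  ⟨fun x => ⟨x.unit⁻¹ * unitScalar A (bicharacter α x.exponent x.exponent), -x.exponent⟩⟩

@[simp] theorem unit_mul (x y : TwistedUnits A α) : (x * y).unit =
    x.unit * y.unit * unitScalar A (bicharacter α x.exponent y.exponent) := rfl
@[simp] theorem exponent_mul (x y : TwistedUnits A α) :
    (x * y).exponent = x.exponent + y.exponent := rfl
omit [Fintype ι] in
@[simp] theorem unit_one : (1 : TwistedUnits A α).unit = 1 := rfl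
omit [Fintype ι] in
@[simp] theorem exponent_one : (1 : TwistedUnits A α).exponent = 0 := rfl
@[simp] theorem unit_inv (x : TwistedUnits A α) : x⁻¹.unit =
    x.unit⁻¹ * unitScalar A (bicharacter α x.exponent x.exponent) := rfl
@[simp] theorem exponent_inv (x : TwistedUnits A α) : x⁻¹.exponent = -x.exponent := rfl

instance : Group (TwistedUnits A α) :=
  Group.ofLeftAxioms
    (fun x y z => by
      ext1
      · simp only [unit_mul, exponent_mul, bicharacter_add_left, bicharacter_add_right, map_mul]
        rw [mul_assoc x.unit, mul_assoc x.unit, mul_assoc y.unit, unitScalar_mul_comm]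
        simp only [mul_assoc, ← map_mul, mul_comm]
      · exact add_assoc _ _ _)
    (fun x => by ext1 <;> simp)
    (fun x => by
      ext1
      · simp only [unit_mul, unit_inv, exponent_inv, unit_one]
        rw [mul_assoc x.unit⁻¹, unitScalar_mul_comm, ← mul_assoc, inv_mul_cancel, one_mul,
          ← map_mul, ← bicharacter_add_left, add_neg_cancel, bicharacter_zero_left, map_one]
      · simp)

/-- The inclusion of the scalars in the twisted product. -/
def scalar : kˣ →* TwistedUnits A α where
  toFun s := ⟨unitScalar A s, 0⟩
  map_one' := by ext1 <;> simp
  map_mul' _ _ := by ext1 <;> simp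

@[simp] theorem unit_scalar (s : kˣ) :
    (scalar s : TwistedUnits A α).unit = unitScalar A s := rfl
@[simp] theorem exponent_scalar (s : kˣ) : (scalar s : TwistedUnits A α).exponent = 0 := rfl

theorem scalar_mul_comm (s : kˣ) (x : TwistedUnits A α) : scalar s * x = x * scalar s := by
  ext1
  · simp [unitScalar_mul_comm]
  · simp

theorem scalar_injective [Nontrivial A] :
    Function.Injective (scalar : kˣ →* TwistedUnits A α) := fun _ _ h =>
  Units.ext ((algebraMap k A).injective (congrArg (fun x => ((x.unit : Aˣ) : A)) h))

end TwistedUnits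

theorem exists_units_matrix_anticommuting (k : Type*) [Field k] [IsAlgClosed k] :
    ∃ r s c : (Matrix (Fin 2) (Fin 2) k)ˣ,
      r * s = c * (s * r) ∧ r * c = c * r ∧ s * c = -1 * (c * s) ∧ c ^ 2 = -1 := by
  obtain ⟨i, hi⟩ := IsAlgClosed.exists_pow_nat_eq (-1 : k) (n := 2) (by norm_num)
  have hi' : i * i = -1 := by rw [← hi, sq]
  refine ⟨⟨!![1, 0; 0, i], !![1, 0; 0, -i], ?_, ?_⟩, ⟨!![0, 1; 1, 0], !![0, 1; 1, 0], ?_, ?_⟩,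
    ⟨!![-i, 0; 0, i], !![i, 0; 0, -i], ?_, ?_⟩, ?_, ?_, ?_, ?_⟩ <;>
  first
  | (apply Units.ext; simp [Matrix.one_fin_two, hi', sq])
  | simp [Matrix.one_fin_two, hi']

theorem exists_units_matrix_of_signs {k : Type*} [Field k] [IsAlgClosed k] (ε₁ ε₂ : kˣ)
    (h₁ : ε₁ ^ 2 = 1) (h₂ : ε₂ ^ 2 = 1) :
    ∃ (m₁ m₂ c : (Matrix (Fin 2) (Fin 2) k)ˣ) (t : kˣ), m₁ * m₂ = c * (m₂ * m₁) ∧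
      m₁ * c = TwistedUnits.unitScalar _ ε₁ * (c * m₁) ∧
      m₂ * c = TwistedUnits.unitScalar _ ε₂ * (c * m₂) ∧ c ^ 2 = TwistedUnits.unitScalar _ t := by
  have hneg : TwistedUnits.unitScalar (Matrix (Fin 2) (Fin 2) k) (-1 : kˣ) = -1 :=
    Units.ext (by simp)
  have hcases : ∀ ε : kˣ, ε ^ 2 = 1 → ε = 1 ∨ ε = -1 := by
    intro ε h
    rcases sq_eq_sq_iff_eq_or_eq_neg.mp (by simpa using congrArg Units.val h :
      (ε : k) ^ 2 = 1 ^ 2) with h | h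
    · exact Or.inl (Units.ext h)
    · exact Or.inr (Units.ext (by simpa using h))
  obtain ⟨r, s, c, h, hr, hs, hc⟩ := exists_units_matrix_anticommuting k
  have hsc : s * c⁻¹ = -1 * (c⁻¹ * s) := by
    rw [mul_inv_eq_iff_eq_mul]
    simp [mul_assoc, hs]
  rcases hcases _ h₁ with rfl | rfl <;> rcases hcases _ h₂ with rfl | rfl
  · exact ⟨1, 1, 1, 1, by simp⟩
  · exact ⟨r, s, c, -1, h, by simpa using hr, by rw [hneg, hs], by rw [hneg, hc]⟩
  · refine ⟨s, r, c⁻¹, -1, ?_, ?_, ?_, ?_⟩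
    · rw [h, inv_mul_cancel_left]
    · rw [hneg, hsc]
    · simpa using (show Commute r c from hr).inv_right.eq
    · rw [hneg, inv_pow, hc]; simp
  · refine ⟨s, r * s, c⁻¹, -1, ?_, ?_, ?_, ?_⟩
    · rw [h]; simp only [mul_assoc, inv_mul_cancel_left]; rw [h]
    · rw [hneg, hsc]
    · rw [hneg, mul_assoc, hsc, ← mul_assoc c⁻¹, ← (show Commute r c from hr).inv_right.eq]
      simp [mul_assoc]
    · rw [hneg, inv_pow, hc]; simp

universe u in
theorem exists_lift_of_commutation_data {k : Type u} [Field k] [IsAlgClosed k]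
    (ε₁ ε₂ t x y w z u : kˣ) (h₁ : ε₁ ^ 2 = 1) (h₂ : ε₂ ^ 2 = 1) :
    ∃ (E : Type u) (_ : Group E) (j : kˣ →* E) (x₁ x₂ x₃ x₄ K : E),
      Function.Injective j ∧ (∀ s e, j s * e = e * j s) ∧ x₁ * x₂ = K * (x₂ * x₁) ∧
      x₁ * K * x₁⁻¹ = j ε₁ * K ∧ x₂ * K * x₂⁻¹ = j ε₂ * K ∧ Commute x₃ K ∧ Commute x₄ K ∧
      K ^ 2 = j t ∧
      x₁ * x₃ * x₁⁻¹ = j x * x₃ ∧ x₁ * x₄ * x₁⁻¹ = j y * x₄ ∧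
      x₂ * x₃ * x₂⁻¹ = j w * x₃ ∧ x₂ * x₄ * x₂⁻¹ = j z * x₄ ∧ x₃ * x₄ * x₃⁻¹ = j u * x₄ := by
  obtain ⟨m₁, m₂, c, t₀, h, hc₁, hc₂, hcc⟩ := exists_units_matrix_of_signs ε₁ ε₂ h₁ h₂
  obtain ⟨μ, hμ⟩ : ∃ μ : kˣ, μ ^ 2 * t₀ = t := by
    obtain ⟨b, hb⟩ := IsAlgClosed.exists_pow_nat_eq ((t * t₀⁻¹ : kˣ) : k) (n := 2) (by norm_num)
    have hb0 : b ≠ 0 := by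
      rintro rfl
      exact (t * t₀⁻¹).ne_zero (by simpa using hb.symm)
    refine ⟨Units.mk0 b hb0, ?_⟩
    rw [show Units.mk0 b hb0 ^ 2 = t * t₀⁻¹ from Units.ext (by simpa using hb)]
    group
  let α : Fin 4 → Fin 4 → kˣ := ![![1, μ, x, y], ![1, 1, w, z], ![1, 1, 1, u], ![1, 1, 1, 1]]
  let J := TwistedUnits.unitScalar (k := k) (Matrix (Fin 2) (Fin 2) k)
  have hJ : ∀ s v, v * J s = J s * v := fun s v => (TwistedUnits.unitScalar_mul_comm s v).symm
  have hcomm : ∀ {m ε}, m * c = J ε * (c * m) → m * (J μ * c) = J ε * (J μ * c) * m := by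
    intro m ε h
    rw [← mul_assoc, hJ, mul_assoc, h, ← mul_assoc, ← hJ μ]
    simp only [mul_assoc]
  refine ⟨TwistedUnits (Matrix (Fin 2) (Fin 2) k) α, inferInstance, TwistedUnits.scalar,
    ⟨m₁, Pi.single 0 1⟩, ⟨m₂, Pi.single 1 1⟩, ⟨1, Pi.single 2 1⟩, ⟨1, Pi.single 3 1⟩,
    ⟨J μ * c, 0⟩, TwistedUnits.scalar_injective, TwistedUnits.scalar_mul_comm, ?_, ?_, ?_, ?_, ?_,
    ?_, ?_, ?_, ?_, ?_, ?_⟩ <;>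
  try simp only [mul_inv_eq_iff_eq_mul, commute_iff_eq, sq]
  all_goals ext1
  all_goals simp [α, add_comm]
  · exact (hJ μ _).trans (by rw [h, mul_assoc])
  · exact hcomm hc₁
  · exact hcomm hc₂
  · rw [mul_assoc, ← mul_assoc c, hJ, mul_assoc, ← sq, hcc, ← map_mul, ← map_mul, ← mul_assoc, ← sq,
      hμ]
  all_goals exact hJ _ _

theorem conj_normal_form {C E : Type*} [CommGroup C] [Group E] (j : C →* E)
    (hj : ∀ s e, j s * e = e * j s) {y x₁ x₂ x₃ x₄ x₅ : E} {s₁ s₂ s₃ s₄ s₅ : C}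
    (h₁ : y * x₁ * y⁻¹ = j s₁ * x₁) (h₂ : y * x₂ * y⁻¹ = j s₂ * x₂)
    (h₃ : y * x₃ * y⁻¹ = j s₃ * x₃) (h₄ : y * x₄ * y⁻¹ = j s₄ * x₄)
    (h₅ : y * x₅ * y⁻¹ = j s₅ * x₅) (a b c d e : ℤ) :
    y * (x₁ ^ a * x₂ ^ b * x₃ ^ c * x₄ ^ d * x₅ ^ e) * y⁻¹ =
      j (s₁ ^ a * s₂ ^ b * s₃ ^ c * s₄ ^ d * s₅ ^ e) *
        (x₁ ^ a * x₂ ^ b * x₃ ^ c * x₄ ^ d * x₅ ^ e) := by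
  have hz : ∀ {x s}, y * x * y⁻¹ = j s * x → ∀ n : ℤ, y * x ^ n * y⁻¹ = j (s ^ n) * x ^ n := by
    intro x s h n
    rw [← conj_zpow, h, (show Commute (j s) x from hj s x).mul_zpow, map_zpow]
  have hm : ∀ {x x' s s'}, y * x * y⁻¹ = j s * x → y * x' * y⁻¹ = j s' * x' →
      y * (x * x') * y⁻¹ = j (s * s') * (x * x') := by
    intro x x' s s' h h'
    rw [← conj_mul, h, h', map_mul, mul_assoc, mul_assoc, ← mul_assoc x, ← hj s' x, mul_assoc]
  exact hm (hm (hm (hm (hz h₁ a) (hz h₂ b)) (hz h₃ c)) (hz h₄ d)) (hz h₅ e)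

theorem exists_cocycle_of_lift {k : Type*} [Field k] [IsAlgClosed k] {E G : Type*} [Group E]
    [Group G] {g₁ g₂ g₃ g₄ κ : G} (hκ : ∀ x : G, Commute κ x)
    (hg₁₂ : g₁ * g₂ = κ * (g₂ * g₁)) (hg₃ : ∀ x, Commute g₃ x) (hg₄ : ∀ x, Commute g₄ x)
    (hgen : Subgroup.closure {g₁, g₂, g₃, g₄} = ⊤)
    (j : kˣ →* E) (hj : Function.Injective j) (hjc : ∀ s e, j s * e = e * j s)
    {x₁ x₂ x₃ x₄ K : E} {ε₁ ε₂ x y w z u : kˣ} (hx₁₂ : x₁ * x₂ = K * (x₂ * x₁))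
    (hK₁ : x₁ * K * x₁⁻¹ = j ε₁ * K) (hK₂ : x₂ * K * x₂⁻¹ = j ε₂ * K)
    (hK₃ : Commute x₃ K) (hK₄ : Commute x₄ K)
    (h₁₃ : x₁ * x₃ * x₁⁻¹ = j x * x₃) (h₁₄ : x₁ * x₄ * x₁⁻¹ = j y * x₄)
    (h₂₃ : x₂ * x₃ * x₂⁻¹ = j w * x₃) (h₂₄ : x₂ * x₄ * x₂⁻¹ = j z * x₄)
    (h₃₄ : x₃ * x₄ * x₃⁻¹ = j u * x₄)
    (hrel : ∀ a b c d e : ℤ, g₁ ^ a * g₂ ^ b * g₃ ^ c * g₄ ^ d * κ ^ e = 1 →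
      ∀ v ∈ ({x₁, x₂, x₃, x₄} : Set E), Commute v (x₁ ^ a * x₂ ^ b * x₃ ^ c * x₄ ^ d * K ^ e)) :
    ∃ σ : G → G → kˣ,
      (∀ a b c : G, σ a b * σ (a * b) c = σ a (b * c) * σ b c) ∧
      σ g₁ κ * (σ κ g₁)⁻¹ = ε₁ ∧ σ g₂ κ * (σ κ g₂)⁻¹ = ε₂ ∧
      σ g₃ κ * (σ κ g₃)⁻¹ = 1 ∧ σ g₄ κ * (σ κ g₄)⁻¹ = 1 := by
  let S : Subgroup (E × G) := j.range.prod ⊥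
  have hS : S.Normal := by
    refine ⟨?_⟩
    rintro ⟨_, _⟩ ⟨⟨s, rfl⟩, rfl⟩ ⟨e, g⟩
    exact ⟨⟨s, by simp [← hjc]⟩, by simp⟩
  let q := QuotientGroup.mk' S
  have hq : ∀ {a b : E × G}, (∃ s, a.1 = j s * b.1) → a.2 = b.2 → q a = q b := by
    rintro ⟨a, g⟩ ⟨b, g'⟩ ⟨s, rfl⟩ (rfl : g = g')
    refine QuotientGroup.eq.mpr ⟨⟨s⁻¹, ?_⟩, ?_⟩
    · change j s⁻¹ = (j s * b)⁻¹ * b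
      rw [mul_inv_rev, ← map_inv, ← hjc, inv_mul_cancel_right]
    · simp
  have hqc : ∀ {a b : E} {g g' : G} {s : kˣ}, a * b * a⁻¹ = j s * b → Commute g g' →
      Commute (q (a, g)) (q (b, g')) := by
    intro a b g g' s h hg
    rw [mul_inv_eq_iff_eq_mul] at h
    rw [commute_iff_eq, ← map_mul, ← map_mul]
    exact hq ⟨s, by simp [h, mul_assoc]⟩ hg.eq
  have hKc : ∀ {a : E}, Commute a K → a * K * a⁻¹ = j 1 * K := by
    intro a h; rw [h.eq]; simp
  let T : Set ((E × G) ⧸ S) := {q (x₁, g₁), q (x₂, g₂), q (x₃, g₃), q (x₄, g₄)}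
  let P := (Subgroup.closure T).comap q
  have hnf : ∀ p ∈ P, ∃ (a b c d e : ℤ) (s : kˣ),
      p.1 = j s * (x₁ ^ a * x₂ ^ b * x₃ ^ c * x₄ ^ d * K ^ e) ∧
      p.2 = g₁ ^ a * g₂ ^ b * g₃ ^ c * g₄ ^ d * κ ^ e := by
    intro p hp
    obtain ⟨a, b, c, d, e, h⟩ := exists_normal_form_of_mem_closure (K := q (K, κ))
      (by simp only [← map_mul, Prod.mk_mul_mk, hx₁₂, hg₁₂])
      (hqc hK₁ (hκ _).symm).symm (hqc hK₂ (hκ _).symm).symm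
      (hqc h₁₃ (hg₃ _).symm) (hqc h₁₄ (hg₄ _).symm) (hqc h₂₃ (hg₃ _).symm)
      (hqc h₂₄ (hg₄ _).symm) (hqc h₃₄ (hg₄ _).symm) hp
    simp only [← map_mul, ← map_zpow] at h
    obtain ⟨⟨s, hs⟩, hg⟩ := QuotientGroup.eq.mp h.symm
    refine ⟨a, b, c, d, e, s, ?_, ?_⟩
    · rw [hjc, hs]; simp [mul_assoc]
    · have := (eq_of_inv_mul_eq_one hg).symm
      simpa using this
  have hgenP : ∀ {v : E} {g : G}, q (v, g) ∈ T → (v, g) ∈ P :=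
    fun h => Subgroup.subset_closure h
  have h₁P : (x₁, g₁) ∈ P := hgenP (by simp [T])
  have h₂P : (x₂, g₂) ∈ P := hgenP (by simp [T])
  have h₃P : (x₃, g₃) ∈ P := hgenP (by simp [T])
  have h₄P : (x₄, g₄) ∈ P := hgenP (by simp [T])
  have hKP : (K, κ) ∈ P := by
    have : ((K, κ) : E × G) = (x₁, g₁) * (x₂, g₂) * ((x₂, g₂) * (x₁, g₁))⁻¹ := by
      simp only [Prod.mk_mul_mk, hx₁₂, hg₁₂, Prod.inv_mk, mul_inv_cancel_right]
    rw [this]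
    exact P.mul_mem (P.mul_mem h₁P h₂P) (P.inv_mem (P.mul_mem h₂P h₁P))
  have hjP : ∀ s, (j s, (1 : G)) ∈ P := by
    intro s
    have : q (j s, 1) = 1 := by
      rw [← map_one q]
      exact hq ⟨s, by simp⟩ rfl
    exact (congrArg (· ∈ Subgroup.closure T) this).mpr (one_mem _)
  obtain ⟨σ, hσ, hσc⟩ := exists_cocycle_of_central_extension
    (P := P) ((MonoidHom.snd E G).comp P.subtype)
    (by
      have : (⊤ : Subgroup G) ≤ ((MonoidHom.snd E G).comp P.subtype).range := by
        rw [← hgen, Subgroup.closure_le]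
        rintro g (rfl | rfl | rfl | rfl)
        exacts [⟨⟨_, h₁P⟩, rfl⟩, ⟨⟨_, h₂P⟩, rfl⟩, ⟨⟨_, h₃P⟩, rfl⟩, ⟨⟨_, h₄P⟩, rfl⟩]
      exact MonoidHom.range_eq_top.mp (top_le_iff.mp this))
    (by
      rintro ⟨⟨v, g⟩, hv⟩ hg ⟨⟨v', g'⟩, hv'⟩
      obtain rfl : g = 1 := hg
      obtain ⟨a, b, c, d, e, s, rfl, hg⟩ := hnf _ hv
      obtain ⟨a', b', c', d', e', s', hv'', -⟩ := hnf _ hv'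
      have hr := hrel _ _ _ _ _ hg.symm
      generalize x₁ ^ a * x₂ ^ b * x₃ ^ c * x₄ ^ d * K ^ e = n at hr hv ⊢
      have hx₁ := hr x₁ (by simp)
      have hx₂ := hr x₂ (by simp)
      have hx₃ := hr x₃ (by simp)
      have hx₄ := hr x₄ (by simp)
      have hxK : Commute K n := by
        rw [← mul_inv_eq_iff_eq_mul.mpr hx₁₂]
        exact (hx₁.mul_left hx₂).mul_left (hx₂.mul_left hx₁).inv_left
      have hn : Commute v' n := by
        rw [show v' = _ from hv'']
        exact Commute.mul_left (hjc s' n) (((((hx₁.zpow_left a').mul_left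
          (hx₂.zpow_left b')).mul_left (hx₃.zpow_left c')).mul_left
          (hx₄.zpow_left d')).mul_left (hxK.zpow_left e'))
      have hjn : Commute v' (j s) := (hjc s v').symm
      exact Subtype.ext (Prod.ext (hjn.mul_right hn).eq (by simp)))
    ((j.prod 1).codRestrict P hjP)
    (fun a b h => hj (congrArg (fun p : P => p.1.1) h))
    (fun s => rfl)
  have hκG : ∀ g, g * κ * g⁻¹ = κ := fun g => by rw [← (hκ g).eq, mul_inv_cancel_right]
  refine ⟨σ, hσ, ?_, ?_, ?_, ?_⟩
  · exact hσc ⟨_, h₁P⟩ ⟨_, hKP⟩ ε₁ (Subtype.ext (Prod.ext hK₁ ((hκG _).trans (one_mul κ).symm)))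
  · exact hσc ⟨_, h₂P⟩ ⟨_, hKP⟩ ε₂ (Subtype.ext (Prod.ext hK₂ ((hκG _).trans (one_mul κ).symm)))
  · exact hσc ⟨_, h₃P⟩ ⟨_, hKP⟩ 1 (Subtype.ext (Prod.ext (hKc hK₃) ((hκG _).trans (one_mul κ).symm)))
  · exact hσc ⟨_, h₄P⟩ ⟨_, hKP⟩ 1 (Subtype.ext (Prod.ext (hKc hK₄) ((hκG _).trans (one_mul κ).symm)))

theorem even_exponents_of_normal_form_eq_one {G : Type*} [Group G] {κ g₁ g₂ g₃ g₄ : G}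
    (hκc : ∀ x : G, κ * x = x * κ) (hκ1 : κ ≠ 1) (hκ2 : κ ^ 2 = 1)
    (hcomm₁₂ : g₁ * g₂ = κ * (g₂ * g₁)) (hg₃c : ∀ x : G, g₃ * x = x * g₃)
    (hg₄c : ∀ x : G, g₄ * x = x * g₄) {a b c d e : ℤ}
    (h : g₁ ^ a * g₂ ^ b * g₃ ^ c * g₄ ^ d * κ ^ e = 1) : 2 ∣ a ∧ 2 ∣ b := by
  let j : Multiplicative ℤ →* G := zpowersHom G κ
  have hjc : ∀ s x, j s * x = x * j s := fun s x => Commute.zpow_left (hκc x) s.toAdd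
  have hcen : ∀ {v x : G}, v * x = x * v → v * x * v⁻¹ = j 1 * x := fun h => by
    rw [h]; simp
  have h₁₂ : g₁ * g₂ * g₁⁻¹ = j (Multiplicative.ofAdd 1) * g₂ := by
    rw [hcomm₁₂]; simp [j, mul_assoc]
  have h₂₁ : g₂ * g₁ * g₂⁻¹ = j (Multiplicative.ofAdd (-1)) * g₁ := by
    rw [mul_inv_eq_iff_eq_mul, mul_assoc, hcomm₁₂]; simp [j]
  have hord : orderOf κ = 2 := orderOf_eq_prime hκ2 hκ1
  have hdvd : ∀ n : ℤ, κ ^ n = 1 → 2 ∣ n := fun n hn => by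
    simpa [hord] using orderOf_dvd_iff_zpow_eq_one.mpr hn
  have ha := conj_normal_form j hjc h₂₁ (hcen rfl) (hcen (hg₃c g₂).symm) (hcen (hg₄c g₂).symm)
    (hcen (hκc g₂).symm) a b c d e
  have hb := conj_normal_form j hjc (hcen rfl) h₁₂ (hcen (hg₃c g₁).symm) (hcen (hg₄c g₁).symm)
    (hcen (hκc g₁).symm) a b c d e
  rw [h] at ha hb
  refine ⟨?_, hdvd b ?_⟩
  · rw [← dvd_neg]
    refine hdvd (-a) ?_
    simpa [j] using ha.symm
  · simpa [j] using hb.symm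

theorem commute_normal_form_of_scalar_relations {C E : Type*} [CommGroup C] [Group E]
    {j : C →* E} (hjc : ∀ s e, j s * e = e * j s)
    {x₁ x₂ x₃ x₄ K : E} {ε₁ ε₂ t x y w z u : C} (hx₁₂ : x₁ * x₂ = K * (x₂ * x₁))
    (hK₁ : x₁ * K * x₁⁻¹ = j ε₁ * K) (hK₂ : x₂ * K * x₂⁻¹ = j ε₂ * K)
    (hK₃ : Commute x₃ K) (hK₄ : Commute x₄ K) (hK : K ^ 2 = j t)
    (h₁₃ : x₁ * x₃ * x₁⁻¹ = j x * x₃) (h₁₄ : x₁ * x₄ * x₁⁻¹ = j y * x₄)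
    (h₂₃ : x₂ * x₃ * x₂⁻¹ = j w * x₃) (h₂₄ : x₂ * x₄ * x₂⁻¹ = j z * x₄)
    (h₃₄ : x₃ * x₄ * x₃⁻¹ = j u * x₄) {a b c d e : ℤ}
    (s₁ : (ε₂ * t) ^ b * x ^ c * y ^ d * ε₁ ^ e = 1)
    (s₂ : (ε₁ * t)⁻¹ ^ a * w ^ c * z ^ d * ε₂ ^ e = 1)
    (s₃ : (x⁻¹ ^ 2) ^ a * (w⁻¹ ^ 2) ^ b * u ^ d = 1)
    (s₄ : (y⁻¹ ^ 2) ^ a * (z⁻¹ ^ 2) ^ b * u⁻¹ ^ c = 1) :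
    ∀ v ∈ ({x₁, x₂, x₃, x₄} : Set E),
      Commute v (x₁ ^ (2 * a) * x₂ ^ (2 * b) * x₃ ^ c * x₄ ^ d * K ^ e) := by
  have hcen : ∀ {v x : E}, Commute v x → v * x * v⁻¹ = j 1 * x := fun h => by
    rw [h.eq]; simp
  have hflip : ∀ {v x : E} {s : C}, v * x * v⁻¹ = j s * x → x * v * x⁻¹ = j s⁻¹ * v := by
    intro v x s h
    rw [mul_inv_eq_iff_eq_mul] at h ⊢
    rw [mul_assoc, h, ← mul_assoc, ← mul_assoc, ← map_mul, inv_mul_cancel, map_one, one_mul]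
  have hsq : ∀ {v x : E} {s : C}, v * x * v⁻¹ = j s * x → v * x ^ 2 * v⁻¹ = j (s ^ 2) * x ^ 2 := by
    intro v x s h
    rw [← conj_pow, h, (show Commute (j s) x from hjc s x).mul_pow, map_pow]
  have h₁₂ : x₁ * x₂ ^ 2 * x₁⁻¹ = j (ε₂ * t) * x₂ ^ 2 := by
    have h : x₁ * x₂ * x₁⁻¹ = K * x₂ := by rw [hx₁₂]; group
    rw [mul_inv_eq_iff_eq_mul] at hK₂
    rw [← conj_pow, h, sq, mul_assoc, ← mul_assoc x₂, hK₂, map_mul, ← hK]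
    simp only [sq, mul_assoc]
    rw [← mul_assoc K (j ε₂), ← hjc, mul_assoc]
  have h₂₁ : x₂ * x₁ ^ 2 * x₂⁻¹ = j (ε₁ * t)⁻¹ * x₁ ^ 2 := by
    refine hflip ?_
    rw [mul_inv_eq_iff_eq_mul] at hK₁ ⊢
    rw [sq, mul_assoc, hx₁₂, ← mul_assoc, hK₁, mul_assoc, mul_assoc, ← mul_assoc x₁, hx₁₂, map_mul,
      ← hK]
    simp only [sq, mul_assoc]
  have hfin : ∀ {v m : E} {s : C}, v * m * v⁻¹ = j s * m → s = 1 → Commute v m := by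
    rintro v m s h rfl
    rwa [map_one, one_mul, mul_inv_eq_iff_eq_mul] at h
  rw [zpow_mul, zpow_mul, zpow_ofNat, zpow_ofNat]
  rintro v (rfl | rfl | rfl | rfl)
  · exact hfin (conj_normal_form j hjc (hcen ((Commute.refl _).pow_right 2)) h₁₂ h₁₃ h₁₄ hK₁ ..)
      (by simpa using s₁)
  · exact hfin (conj_normal_form j hjc h₂₁ (hcen ((Commute.refl _).pow_right 2)) h₂₃ h₂₄ hK₂ ..)
      (by simpa using s₂)
  · exact hfin (conj_normal_form j hjc (hsq (hflip h₁₃)) (hsq (hflip h₂₃)) (hcen (Commute.refl _))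
      h₃₄ (hcen hK₃) ..) (by simpa using s₃)
  · exact hfin (conj_normal_form j hjc (hsq (hflip h₁₄)) (hsq (hflip h₂₄)) (hflip h₃₄)
      (hcen (Commute.refl _)) (hcen hK₄) ..) (by simpa using s₄)

/-- Type `φ₄` (Cartan matrix `F₄`): there is a 2-cocycle `σ` on `G`
trivializing the action of `κ` on the twisted characters. -/
theorem stmt_11 {k : Type*} [Field k] [IsAlgClosed k] [CharZero k]
    {G : Type*} [Group G] (κ g₁ g₂ g₃ g₄ : G)
    (hκc : ∀ x : G, κ * x = x * κ) (hκ1 : κ ≠ 1) (hκ2 : κ ^ 2 = 1)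
    (hc₁ : ∀ x : G, x * g₁ * x⁻¹ = g₁ ∨ x * g₁ * x⁻¹ = κ * g₁)
    (hc₁' : ∃ x : G, x * g₁ * x⁻¹ = κ * g₁)
    (hc₂ : ∀ x : G, x * g₂ * x⁻¹ = g₂ ∨ x * g₂ * x⁻¹ = κ * g₂)
    (hc₂' : ∃ x : G, x * g₂ * x⁻¹ = κ * g₂)
    (hcomm₁₂ : g₁ * g₂ = κ * (g₂ * g₁))
    (hg₃c : ∀ x : G, g₃ * x = x * g₃)
    (hg₄c : ∀ x : G, g₄ * x = x * g₄)
    (hgen : Subgroup.closure {g₁, g₂, g₃, g₄} = ⊤)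
    (χ₁ : ↥(Subgroup.centralizer {g₁}) →* kˣ)
    (χ₂ : ↥(Subgroup.centralizer {g₂}) →* kˣ)
    (χ₃ : G →* kˣ) (χ₄ : G →* kˣ)
    (hχ₁ : ∀ hm : g₁ ∈ Subgroup.centralizer {g₁}, χ₁ ⟨g₁, hm⟩ = -1)
    (hχ₂ : ∀ hm : g₂ ∈ Subgroup.centralizer {g₂}, χ₂ ⟨g₂, hm⟩ = -1)
    (hχ₃ : χ₃ g₃ = -1) (hχ₄ : χ₄ g₄ = -1)
    (hcompat₁₂ : ∀ (h₁ : κ * g₂ ^ 2 ∈ Subgroup.centralizer {g₁})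
        (h₂ : κ * g₁ ^ 2 ∈ Subgroup.centralizer {g₂}),
      χ₁ ⟨κ * g₂ ^ 2, h₁⟩ * χ₂ ⟨κ * g₁ ^ 2, h₂⟩ = 1)
    (hcompat₁₃ : ∀ h₁ : g₃ ∈ Subgroup.centralizer {g₁},
      χ₁ ⟨g₃, h₁⟩ * χ₃ g₁ = 1)
    (hcompat₁₄ : ∀ h₁ : g₄ ∈ Subgroup.centralizer {g₁},
      χ₁ ⟨g₄, h₁⟩ * χ₄ g₁ = 1)
    (hcompat₂₄ : ∀ h₁ : g₄ ∈ Subgroup.centralizer {g₂},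
      χ₂ ⟨g₄, h₁⟩ * χ₄ g₂ = 1)
    (hcompat₃₄ : χ₃ g₄ * χ₄ g₃ = -1)
    (hcompat₂₃ : ∀ h₁ : g₃ ∈ Subgroup.centralizer {g₂},
      χ₂ ⟨g₃, h₁⟩ * χ₃ g₂ = -1) :
    ∃ σ : G → G → kˣ,
      (∀ a b c : G, σ a b * σ (a * b) c = σ a (b * c) * σ b c) ∧
      (∀ hm : κ ∈ Subgroup.centralizer {g₁},
        σ g₁ κ * (σ κ g₁)⁻¹ * χ₁ ⟨κ, hm⟩ = 1) ∧
      (∀ hm : κ ∈ Subgroup.centralizer {g₂},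
        σ g₂ κ * (σ κ g₂)⁻¹ * χ₂ ⟨κ, hm⟩ = 1) ∧
      σ g₃ κ * (σ κ g₃)⁻¹ * χ₃ κ = 1 ∧
      σ g₄ κ * (σ κ g₄)⁻¹ * χ₄ κ = 1 := by
  have hm₁ : ∀ {x : G}, g₁ * x = x * g₁ → x ∈ Subgroup.centralizer {g₁} :=
    fun h => Subgroup.mem_centralizer_singleton_iff.mpr h.symm
  have hm₂ : ∀ {x : G}, g₂ * x = x * g₂ → x ∈ Subgroup.centralizer {g₂} :=
    fun h => Subgroup.mem_centralizer_singleton_iff.mpr h.symm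
  have hκκ : ∀ x : G, κ * (κ * x) = x := fun x => by rw [← mul_assoc, ← sq, hκ2, one_mul]
  have hcomm₂₁ : g₂ * g₁ = κ * (g₁ * g₂) := by rw [hcomm₁₂, hκκ]
  have hsq₂ : g₁ * g₂ ^ 2 = g₂ ^ 2 * g₁ := by
    rw [sq, ← mul_assoc, hcomm₁₂, mul_assoc, mul_assoc, hcomm₁₂, ← mul_assoc g₂ κ, ← hκc, mul_assoc,
      hκκ, mul_assoc]
  have hsq₁ : g₂ * g₁ ^ 2 = g₁ ^ 2 * g₂ := by
    rw [sq, ← mul_assoc, hcomm₂₁, mul_assoc, mul_assoc, hcomm₂₁, ← mul_assoc g₁ κ, ← hκc, mul_assoc,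
      hκκ, mul_assoc]
  have hκ₁ := hm₁ (hκc g₁).symm
  have hκ₂ := hm₂ (hκc g₂).symm
  let ε₁ := χ₁ ⟨κ, hκ₁⟩
  let ε₂ := χ₂ ⟨κ, hκ₂⟩
  let p := χ₁ ⟨g₂ ^ 2, hm₁ hsq₂⟩
  let q := χ₂ ⟨g₁ ^ 2, hm₂ hsq₁⟩
  let x := χ₁ ⟨g₃, hm₁ (hg₃c g₁).symm⟩
  let y := χ₁ ⟨g₄, hm₁ (hg₄c g₁).symm⟩
  let w := χ₂ ⟨g₃, hm₂ (hg₃c g₂).symm⟩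
  let z := χ₂ ⟨g₄, hm₂ (hg₄c g₂).symm⟩
  let u := χ₃ g₄
  have hε₁ : ε₁ ^ 2 = 1 := by
    rw [← map_pow, ← map_one χ₁]
    exact congrArg χ₁ (Subtype.ext hκ2)
  have hε₂ : ε₂ ^ 2 = 1 := by
    rw [← map_pow, ← map_one χ₂]
    exact congrArg χ₂ (Subtype.ext hκ2)
  have hpq : ε₁ * p * (ε₂ * q) = 1 := by
    rw [← map_mul, ← map_mul]
    exact hcompat₁₂ (mul_mem hκ₁ (hm₁ hsq₂)) (mul_mem hκ₂ (hm₂ hsq₁))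
  have hχκ : ∀ χ : G →* kˣ, χ κ = 1 := by
    intro χ
    have := congrArg χ hcomm₁₂
    rw [map_mul, map_mul, map_mul, mul_comm (χ g₂)] at this
    exact mul_eq_right.mp this.symm
  have hx₃ : χ₃ g₁ = x⁻¹ := eq_inv_of_mul_eq_one_right (hcompat₁₃ _)
  have hy₄ : χ₄ g₁ = y⁻¹ := eq_inv_of_mul_eq_one_right (hcompat₁₄ _)
  have hz₄ : χ₄ g₂ = z⁻¹ := eq_inv_of_mul_eq_one_right (hcompat₂₄ _)
  have hw₃ : χ₃ g₂ = -1 / w := eq_div_of_mul_eq' ((mul_comm _ _).trans (hcompat₂₃ _))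
  have hu₄ : χ₄ g₃ = -1 / u := eq_div_of_mul_eq' ((mul_comm _ _).trans hcompat₃₄)
  obtain ⟨E, _, j, x₁, x₂, x₃, x₄, K, hj, hjc, hx₁₂, hK₁, hK₂, hK₃, hK₄, hK, h₁₃, h₁₄, h₂₃, h₂₄,
    h₃₄⟩ := exists_lift_of_commutation_data ε₁ ε₂ (p * ε₂) x y w z u hε₁ hε₂
  obtain ⟨σ, hσ, hσ₁, hσ₂, hσ₃, hσ₄⟩ := exists_cocycle_of_lift (fun x => hκc x) hcomm₁₂
    (fun x => hg₃c x) (fun x => hg₄c x) hgen j hj hjc hx₁₂ hK₁ hK₂ hK₃ hK₄ h₁₃ h₁₄ h₂₃ h₂₄ h₃₄ (by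
    intro a b c d e hr
    obtain ⟨⟨a, rfl⟩, ⟨b, rfl⟩⟩ := even_exponents_of_normal_form_eq_one hκc hκ1 hκ2 hcomm₁₂ hg₃c hg₄c
      hr
    have e₁ : p ^ b * x ^ c * y ^ d * ε₁ ^ e = 1 := by
      have : (⟨g₁, hm₁ rfl⟩ : Subgroup.centralizer {g₁}) ^ (2 * a) *
          ⟨g₂ ^ 2, hm₁ hsq₂⟩ ^ b * ⟨g₃, hm₁ (hg₃c g₁).symm⟩ ^ c *
          ⟨g₄, hm₁ (hg₄c g₁).symm⟩ ^ d * ⟨κ, hκ₁⟩ ^ e = 1 :=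
        Subtype.ext (by simpa [zpow_mul] using hr)
      have h := congrArg χ₁ this
      simp only [map_mul, map_zpow, map_one, hχ₁, zpow_mul, zpow_ofNat, map_pow, neg_one_sq, one_zpow,
        one_mul] at h
      exact h
    have e₂ : q ^ a * w ^ c * z ^ d * ε₂ ^ e = 1 := by
      have : (⟨g₁ ^ 2, hm₂ hsq₁⟩ : Subgroup.centralizer {g₂}) ^ a *
          ⟨g₂, hm₂ rfl⟩ ^ (2 * b) * ⟨g₃, hm₂ (hg₃c g₂).symm⟩ ^ c *
          ⟨g₄, hm₂ (hg₄c g₂).symm⟩ ^ d * ⟨κ, hκ₂⟩ ^ e = 1 :=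
        Subtype.ext (by simpa [zpow_mul] using hr)
      have h := congrArg χ₂ this
      simp only [map_mul, map_zpow, map_one, hχ₂, zpow_mul, zpow_ofNat, map_pow, neg_one_sq, one_zpow,
        mul_one] at h
      exact h
    have e₃ : x⁻¹ ^ (2 * a) * (-1 / w) ^ (2 * b) * (-1) ^ c * u ^ d = 1 := by
      have := congrArg χ₃ hr
      simpa only [map_mul, map_zpow, map_one, hχκ, one_zpow, mul_one, hx₃, hw₃, hχ₃] using this
    have e₄ : y⁻¹ ^ (2 * a) * z⁻¹ ^ (2 * b) * (-1 / u) ^ c * (-1) ^ d = 1 := by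
      have := congrArg χ₄ hr
      simpa only [map_mul, map_zpow, map_one, hχκ, one_zpow, mul_one, hy₄, hz₄, hu₄, hχ₄] using this
    have hne : (-1 : kˣ) ≠ 1 := fun h => by
      have : (-1 : k) = 1 := by simpa using congrArg Units.val h
      norm_num at this
    obtain ⟨hc, hd⟩ := even_of_character_relations (A := Additive kˣ) (m := Additive.ofMul (-1))
      (p := Additive.ofMul p) (q := Additive.ofMul q) (x := Additive.ofMul x)
      (y := Additive.ofMul y) (z := Additive.ofMul z) (w := Additive.ofMul w)
      (u := Additive.ofMul u) (s := Additive.ofMul ε₁) (t := Additive.ofMul ε₂)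
      hne (show (-1 : kˣ) ^ (2 : ℤ) = 1 by simp) (show ε₁ ^ (2 : ℤ) = 1 from hε₁)
      (show ε₂ ^ (2 : ℤ) = 1 from hε₂) hpq e₁ e₂ e₃ e₄
    refine commute_normal_form_of_scalar_relations hjc hx₁₂ hK₁ hK₂ hK₃ hK₄ hK h₁₃ h₁₄ h₂₃ h₂₄ h₃₄
      ?_ ?_ ?_ ?_
    · rwa [mul_left_comm, ← sq, hε₂, mul_one]
    · rwa [← eq_inv_of_mul_eq_one_right (b := q)
        (by rw [← hpq]; simp only [mul_assoc])]
    · rw [zpow_mul, zpow_mul, div_zpow, hc.neg_one_zpow] at e₃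
      simpa using e₃
    · rw [zpow_mul, zpow_mul, div_zpow, hc.neg_one_zpow, hd.neg_one_zpow] at e₄
      simpa using e₄)
  refine ⟨σ, hσ, fun _ => ?_, fun _ => ?_, ?_, ?_⟩
  · rw [hσ₁, ← sq]; exact hε₁
  · rw [hσ₂, ← sq]; exact hε₂
  · rw [hσ₃, hχκ, one_mul]
  · rw [hσ₄, hχκ, one_mul]
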